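/- arXiv:1207.4538 — 5 statements merged into one kernel-verified Lean document; each statement's English description precedes it below -/
import Mathlib

section
/- Let f : ℝⁿ → ℝ be differentiable at x, let μ > 0, let F(x) = f(x) + μ‖x‖₁, let h > 0 and d ∈ ℝⁿ. Then the one-sided directional derivative F′(x; d) = lim_{θ↓0} (F(x + θd) − F(x))/θ exists and satisfies F′(x; d) ≤ ∇f(x)ᵀd + μ(‖x + h·d‖₁ − ‖x‖₁)/h. -/
open Filter Topology

/-- The ℓ1-norm on `ℝⁿ`: `‖v‖₁ = Σᵢ |vᵢ|`. -/
noncomputable def norm1 {n : ℕ} (v : Fin n → ℝ) : ℝ := ∑ i, |v i|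

/-- Along any ray the absolute value is eventually affine near the base point, with a slope `c`
that minorizes all of its difference quotients. -/
lemma exists_slope_abs_add_mul (a b : ℝ) :
    ∃ c : ℝ, (∀ᶠ θ in 𝓝[>] (0 : ℝ), |a + θ * b| - |a| = θ * c) ∧
      ∀ h : ℝ, 0 < h → h * c ≤ |a + h * b| - |a| := by
  have hlim : Tendsto (fun θ : ℝ => a + θ * b) (𝓝[>] 0) (𝓝 a) := by
    have hcont : Continuous fun θ : ℝ => a + θ * b := by fun_prop
    simpa using (hcont.tendsto 0).mono_left nhdsWithin_le_nhds
  rcases lt_trichotomy a 0 with ha | rfl | ha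
  · refine ⟨-b, ?_, fun h _ => ?_⟩
    · filter_upwards [hlim.eventually_lt_const ha] with θ hθ
      rw [abs_of_neg ha, abs_of_neg hθ]
      ring
    · rw [abs_of_neg ha]
      linarith [neg_abs_le (a + h * b)]
  · refine ⟨|b|, ?_, fun h hh => ?_⟩
    · filter_upwards [self_mem_nhdsWithin] with θ hθ
      simp [abs_mul, abs_of_pos (Set.mem_Ioi.mp hθ)]
    · simp [abs_mul, abs_of_pos hh]
  · refine ⟨b, ?_, fun h _ => ?_⟩
    · filter_upwards [hlim.eventually_const_lt ha] with θ hθ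
      rw [abs_of_pos ha, abs_of_pos hθ]
      ring
    · rw [abs_of_pos ha]
      linarith [le_abs_self (a + h * b)]

lemma exists_slope_norm1_add_smul {n : ℕ} (x d : Fin n → ℝ) :
    ∃ c : ℝ, (∀ᶠ θ in 𝓝[>] (0 : ℝ), norm1 (x + θ • d) - norm1 x = θ * c) ∧
      ∀ h : ℝ, 0 < h → h * c ≤ norm1 (x + h • d) - norm1 x := by
  choose c hc hle using fun i => exists_slope_abs_add_mul (x i) (d i)
  refine ⟨∑ i, c i, ?_, fun h hh => ?_⟩
  · filter_upwards [eventually_all.2 hc] with θ hθ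
    simp only [norm1, ← Finset.sum_sub_distrib, Finset.mul_sum]
    exact Finset.sum_congr rfl fun i _ => hθ i
  · simp only [norm1, ← Finset.sum_sub_distrib, Finset.mul_sum]
    exact Finset.sum_le_sum fun i _ => hle i h hh

/-- Let `f : ℝⁿ → ℝ` be differentiable at `x`, let `μ > 0`, let
`F(x) = f(x) + μ‖x‖₁`, let `h > 0` and `d ∈ ℝⁿ`. Then the one-sided directional derivative
`F′(x; d) = lim_{θ↓0} (F(x + θd) − F(x))/θ` exists and satisfies
`F′(x; d) ≤ ∇f(x)ᵀd + μ(‖x + h·d‖₁ − ‖x‖₁)/h`. -/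
theorem dirDeriv_exists_le {n : ℕ} (f : (Fin n → ℝ) → ℝ) (x : Fin n → ℝ)
    (hf : DifferentiableAt ℝ f x) (μ : ℝ) (hμ : 0 < μ)
    (F : (Fin n → ℝ) → ℝ) (hF : ∀ y, F y = f y + μ * norm1 y)
    (h : ℝ) (hh : 0 < h) (d : Fin n → ℝ) :
    ∃ L : ℝ,
      Tendsto (fun θ : ℝ => (F (x + θ • d) - F x) / θ) (𝓝[>] (0 : ℝ)) (𝓝 L) ∧
      L ≤ fderiv ℝ f x d + μ * (norm1 (x + h • d) - norm1 x) / h := by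
  obtain ⟨c, hc, hle⟩ := exists_slope_norm1_add_smul x d
  refine ⟨fderiv ℝ f x d + μ * c, ?_, ?_⟩
  · have hlim := (hf.hasFDerivAt.hasLineDerivAt d).tendsto_slope_zero_right
    refine (hlim.add_const (μ * c)).congr' ?_
    filter_upwards [hc, self_mem_nhdsWithin] with θ hθ hpos
    have hne : θ ≠ 0 := (Set.mem_Ioi.mp hpos).ne'
    rw [hF, hF, smul_eq_mul]
    field_simp
    linear_combination -μ * hθ
  · rw [mul_div_assoc]
    gcongr
    rw [le_div_iff₀ hh, mul_comm]
    exact hle h hh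
end

section
/- For any x, d ∈ ℝⁿ, any h ∈ (0, 1] and any θ ∈ (0, h], one has ‖x + h·d‖₁ − (θ/h)‖x + h²·d‖₁ − (1 − θ/h)‖x‖₁ ≥ (1 − θ)(‖x + h·d‖₁ − ‖x‖₁). -/
/-- Convexity of `r ↦ ‖x + r·d‖₁` on the segment from `0` to `t`. -/
theorem norm1_add_smul_smul_le {n : ℕ} (x d : Fin n → ℝ) {s : ℝ} (t : ℝ)
    (hs0 : 0 ≤ s) (hs1 : s ≤ 1) :
    norm1 (x + (s * t) • d) ≤ (1 - s) * norm1 x + s * norm1 (x + t • d) := by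
  simp only [norm1, Finset.mul_sum, ← Finset.sum_add_distrib]
  refine Finset.sum_le_sum fun i _ => ?_
  simp only [Pi.add_apply, Pi.smul_apply, smul_eq_mul]
  calc |x i + s * t * d i| = |(1 - s) * x i + s * (x i + t * d i)| := by congr 1; ring
    _ ≤ |(1 - s) * x i| + |s * (x i + t * d i)| := abs_add_le _ _
    _ = (1 - s) * |x i| + s * |x i + t * d i| := by
      rw [abs_mul, abs_mul, abs_of_nonneg hs0, abs_of_nonneg (sub_nonneg.2 hs1)]

/-- For any `x, d ∈ ℝⁿ`, any `h ∈ (0, 1]` and any `θ ∈ (0, h]`, one has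
`‖x + h·d‖₁ − (θ/h)‖x + h²·d‖₁ − (1 − θ/h)‖x‖₁ ≥ (1 − θ)(‖x + h·d‖₁ − ‖x‖₁)`. -/
theorem norm1_intermediate_inequality {n : ℕ} (x d : Fin n → ℝ) (h θ : ℝ)
    (hh0 : 0 < h) (hh1 : h ≤ 1) (hθ0 : 0 < θ) (hθh : θ ≤ h) :
    norm1 (x + h • d) - (θ / h) * norm1 (x + (h ^ 2) • d) - (1 - θ / h) * norm1 x ≥
      (1 - θ) * (norm1 (x + h • d) - norm1 x) := by
  have key := mul_le_mul_of_nonneg_left (norm1_add_smul_smul_le x d h hh0.le hh1)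
    (div_pos hθ0 hh0).le
  have hθ : θ / h * h = θ := div_mul_cancel₀ θ hh0.ne'
  rw [← pow_two, mul_add, ← mul_assoc, ← mul_assoc, hθ, mul_sub, hθ, mul_one] at key
  linarith
end

section
/- Let f : ℝⁿ → ℝ be differentiable at x, let μ > 0, λ > 0, h ∈ (0, 1], and let F(x) = f(x) + μ‖x‖₁. If d = 0 is a global minimizer over ℝⁿ of φ(d) = ∇f(x)ᵀd + (λ/2)‖d‖₂² + (μ/h)‖x + h·d‖₁, then x is a stationary point of F, i.e., the one-sided directional derivative satisfies F′(x; v) ≥ 0 for every v ∈ ℝⁿ. -/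
open Filter Topology

/-- The Euclidean (ℓ2) norm on `ℝⁿ`. -/
noncomputable def norm2 {n : ℕ} (v : Fin n → ℝ) : ℝ := Real.sqrt (∑ i, (v i) ^ 2)

/-- One-sided differentiability of `θ ↦ |a + θ b|` at `0`. -/
theorem exists_tendsto_abs_slope (a b : ℝ) :
    ∃ c : ℝ, Tendsto (fun θ : ℝ => (|a + θ * b| - |a|) / θ) (𝓝[>] (0 : ℝ)) (𝓝 c) := by
  rcases eq_or_ne a 0 with rfl | ha
  · refine ⟨|b|, tendsto_const_nhds.congr' ?_⟩
    filter_upwards [self_mem_nhdsWithin] with θ hθ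
    have hθ : 0 < θ := hθ
    rw [zero_add, abs_zero, sub_zero, abs_mul, abs_of_pos hθ]
    field_simp
  · have hlin : HasDerivAt (fun θ : ℝ => a + θ * b) b 0 := by
      simpa using ((hasDerivAt_id (0 : ℝ)).mul_const b).const_add a
    have habs : HasDerivAt (fun θ : ℝ => |a + θ * b|) (SignType.sign a * b) 0 := by
      have h := hasDerivAt_abs ha
      exact HasDerivAt.comp (h := fun θ : ℝ => a + θ * b) 0 (by simpa using h) hlin
    refine ⟨_, habs.tendsto_slope_zero_right.congr fun θ => ?_⟩
    simp [div_eq_inv_mul]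

/-- The ℓ1-norm has one-sided directional derivatives everywhere. -/
theorem exists_tendsto_norm1_slope {n : ℕ} (x v : Fin n → ℝ) :
    ∃ s : ℝ, Tendsto (fun θ : ℝ => (norm1 (x + θ • v) - norm1 x) / θ)
      (𝓝[>] (0 : ℝ)) (𝓝 s) := by
  choose c hc using fun i => exists_tendsto_abs_slope (x i) (v i)
  refine ⟨∑ i, c i, (tendsto_finsetSum Finset.univ fun i _ => hc i).congr fun θ => ?_⟩
  simp [norm1, Finset.sum_div, ← Finset.sum_sub_distrib]

theorem norm2_smul_sq {n : ℕ} (t : ℝ) (v : Fin n → ℝ) :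
    norm2 (t • v) ^ 2 = t ^ 2 * norm2 v ^ 2 := by
  unfold norm2
  rw [Real.sq_sqrt (by positivity), Real.sq_sqrt (by positivity), Finset.mul_sum]
  simp [mul_pow]

/-- Let `f : ℝⁿ → ℝ` be differentiable at `x`, `μ > 0`, `λ > 0`, `h ∈ (0,1]`,
`F(x) = f(x) + μ‖x‖₁`. If `d = 0` is a global minimizer over `ℝⁿ` of
`φ(d) = ∇f(x)ᵀd + (λ/2)‖d‖₂² + (μ/h)‖x + h·d‖₁`, then `x` is a stationary point of `F`,
i.e. the one-sided directional derivative satisfies `F′(x; v) ≥ 0` for every `v ∈ ℝⁿ`. -/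
theorem zero_direction_implies_stationary {n : ℕ} (f : (Fin n → ℝ) → ℝ) (x : Fin n → ℝ)
    (hf : DifferentiableAt ℝ f x) (μ lam h : ℝ)
    (hμ : 0 < μ) (hlam : 0 < lam) (hh0 : 0 < h) (hh1 : h ≤ 1)
    (F : (Fin n → ℝ) → ℝ) (hF : ∀ y, F y = f y + μ * norm1 y)
    (φ : (Fin n → ℝ) → ℝ)
    (hφ : ∀ d, φ d = fderiv ℝ f x d + lam / 2 * (norm2 d) ^ 2 + μ / h * norm1 (x + h • d))
    (hmin : ∀ d : Fin n → ℝ, φ 0 ≤ φ d) :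
    ∀ v : Fin n → ℝ, ∃ L : ℝ,
      Tendsto (fun θ : ℝ => (F (x + θ • v) - F x) / θ) (𝓝[>] (0 : ℝ)) (𝓝 L) ∧ 0 ≤ L := by
  intro v
  obtain ⟨s, hs⟩ := exists_tendsto_norm1_slope x v
  have hline : Tendsto (fun θ : ℝ => θ⁻¹ • (f (x + θ • v) - f x)) (𝓝[>] (0 : ℝ))
      (𝓝 (fderiv ℝ f x v)) :=
    (hf.hasFDerivAt.hasLineDerivAt v).tendsto_slope_zero_right
  refine ⟨fderiv ℝ f x v + μ * s, (hline.add (hs.const_mul μ)).congr fun θ => ?_, ?_⟩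
  · rw [hF, hF, smul_eq_mul]
    ring
  · have hquad : Tendsto (fun θ : ℝ => lam / 2 * (θ / h) * norm2 v ^ 2) (𝓝[>] (0 : ℝ))
        (𝓝 0) := by
      have hcont : Continuous fun θ : ℝ => lam / 2 * (θ / h) * norm2 v ^ 2 := by fun_prop
      simpa using (hcont.tendsto 0).mono_left nhdsWithin_le_nhds
    have hlim := (hquad.const_add (fderiv ℝ f x v)).add (hs.const_mul μ)
    rw [add_zero] at hlim
    refine ge_of_tendsto hlim ?_
    filter_upwards [self_mem_nhdsWithin] with θ hθ
    have hθ : 0 < θ := hθ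
    have hle := hmin ((θ / h) • v)
    have hstep : h • (θ / h) • v = θ • v := by
      rw [smul_smul, mul_div_cancel₀ _ hh0.ne']
    have hzero : norm2 (0 : Fin n → ℝ) = 0 := by simp [norm2]
    rw [hφ, hφ, hstep, norm2_smul_sq, hzero, map_zero, map_smul, smul_zero, add_zero,
      smul_eq_mul] at hle
    have hscale : fderiv ℝ f x v + lam / 2 * (θ / h) * norm2 v ^ 2
        + μ * ((norm1 (x + θ • v) - norm1 x) / θ)
        = h / θ * (θ / h * fderiv ℝ f x v + lam / 2 * ((θ / h) ^ 2 * norm2 v ^ 2)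
          + μ / h * norm1 (x + θ • v) - μ / h * norm1 x) := by
      field_simp
      ring
    rw [hscale]
    exact mul_nonneg (by positivity) (by linarith)
end

section
/- Let f : ℝⁿ → ℝ be differentiable at x, let μ > 0, λ > 0, h ∈ (0, 1], and let F(x) = f(x) + μ‖x‖₁. If d ∈ ℝⁿ is a global minimizer over ℝⁿ of φ(d) = ∇f(x)ᵀd + (λ/2)‖d‖₂² + (μ/h)‖x + h·d‖₁ and d ≠ 0, then the one-sided directional derivative satisfies F′(x; d) ≤ −(λ/2)‖d‖₂² < 0; in particular, x is not a stationary point of F. -/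
open Filter Topology

/-- The right derivative of `t ↦ |a + t b|` at `0` exists and is at most every forward difference
quotient. -/
theorem exists_tendsto_abs_slope_right (a b : ℝ) :
    ∃ l : ℝ, Tendsto (fun t : ℝ => (|a + t * b| - |a|) / t) (𝓝[>] (0 : ℝ)) (𝓝 l) ∧
      ∀ t, 0 < t → l ≤ (|a + t * b| - |a|) / t := by
  have hcont : Tendsto (fun t : ℝ => a + t * b) (𝓝[>] (0 : ℝ)) (𝓝 a) := by
    have h : Continuous (fun t : ℝ => a + t * b) := by fun_prop
    simpa using (h.tendsto 0).mono_left nhdsWithin_le_nhds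
  rcases lt_trichotomy a 0 with ha | rfl | ha
  · refine ⟨-b, tendsto_const_nhds.congr' ?_, fun t ht => ?_⟩
    · filter_upwards [hcont.eventually (gt_mem_nhds ha), self_mem_nhdsWithin] with t h1 h2
      have h2 : (0 : ℝ) < t := h2
      rw [abs_of_neg ha, abs_of_neg h1]
      field_simp
      ring
    · rw [le_div_iff₀ ht, abs_of_neg ha]
      linarith [neg_le_abs (a + t * b)]
  · have key : ∀ t : ℝ, 0 < t → |b| = (|0 + t * b| - |0|) / t := fun t ht => by
      rw [zero_add, abs_mul, abs_of_pos ht, abs_zero]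
      field_simp
      ring
    refine ⟨|b|, tendsto_const_nhds.congr' ?_, fun t ht => (key t ht).le⟩
    filter_upwards [self_mem_nhdsWithin] with t ht using key t ht
  · refine ⟨b, tendsto_const_nhds.congr' ?_, fun t ht => ?_⟩
    · filter_upwards [hcont.eventually (lt_mem_nhds ha), self_mem_nhdsWithin] with t h1 h2
      have h2 : (0 : ℝ) < t := h2
      rw [abs_of_pos ha, abs_of_pos h1]
      field_simp
      ring
    · rw [le_div_iff₀ ht, abs_of_pos ha]
      linarith [le_abs_self (a + t * b)]

/-- The one-sided directional derivative of the `ℓ1`-norm exists and is at most every forward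
difference quotient. -/
theorem exists_tendsto_norm1_slope_right {n : ℕ} (x d : Fin n → ℝ) :
    ∃ l : ℝ, Tendsto (fun t : ℝ => (norm1 (x + t • d) - norm1 x) / t) (𝓝[>] (0 : ℝ)) (𝓝 l) ∧
      ∀ t, 0 < t → l ≤ (norm1 (x + t • d) - norm1 x) / t := by
  choose l hl hle using fun i => exists_tendsto_abs_slope_right (x i) (d i)
  have hsum : ∀ t : ℝ, (norm1 (x + t • d) - norm1 x) / t
      = ∑ i, (|x i + t * d i| - |x i|) / t := fun t => by
    simp only [norm1, Pi.add_apply, Pi.smul_apply, smul_eq_mul, ← Finset.sum_sub_distrib,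
      Finset.sum_div]
  refine ⟨∑ i, l i, ?_, fun t ht => ?_⟩
  · simp only [hsum]
    exact tendsto_finsetSum _ fun i _ => hl i
  · rw [hsum]
    exact Finset.sum_le_sum fun i _ => hle i t ht

theorem norm2_zero {n : ℕ} : norm2 (0 : Fin n → ℝ) = 0 := by
  simp [norm2]

theorem norm2_pos {n : ℕ} {v : Fin n → ℝ} (hv : v ≠ 0) : 0 < norm2 v := by
  obtain ⟨i, hi⟩ := Function.ne_iff.mp hv
  exact Real.sqrt_pos.mpr <| Finset.sum_pos' (fun j _ => sq_nonneg (v j))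
    ⟨i, Finset.mem_univ i, sq_pos_of_ne_zero hi⟩

/-- Let `f : ℝⁿ → ℝ` be differentiable at `x`, `μ > 0`, `λ > 0`, `h ∈ (0,1]`,
`F(x) = f(x) + μ‖x‖₁`. If `d ∈ ℝⁿ` is a global minimizer over `ℝⁿ` of
`φ(d) = ∇f(x)ᵀd + (λ/2)‖d‖₂² + (μ/h)‖x + h·d‖₁` and `d ≠ 0`, then the one-sided
directional derivative satisfies `F′(x; d) ≤ −(λ/2)‖d‖₂² < 0`; in particular `x` is not a
stationary point of `F`. -/
theorem nonzero_direction_is_descent {n : ℕ} (f : (Fin n → ℝ) → ℝ) (x : Fin n → ℝ)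
    (hf : DifferentiableAt ℝ f x) (μ lam h : ℝ)
    (hμ : 0 < μ) (hlam : 0 < lam) (hh0 : 0 < h) (hh1 : h ≤ 1)
    (F : (Fin n → ℝ) → ℝ) (hF : ∀ y, F y = f y + μ * norm1 y)
    (φ : (Fin n → ℝ) → ℝ)
    (hφ : ∀ d', φ d' = fderiv ℝ f x d' + lam / 2 * (norm2 d') ^ 2 + μ / h * norm1 (x + h • d'))
    (d : Fin n → ℝ) (hmin : ∀ d' : Fin n → ℝ, φ d ≤ φ d') (hd : d ≠ 0) :
    ∃ L : ℝ,
      Tendsto (fun θ : ℝ => (F (x + θ • d) - F x) / θ) (𝓝[>] (0 : ℝ)) (𝓝 L) ∧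
      L ≤ -(lam / 2) * (norm2 d) ^ 2 ∧ -(lam / 2) * (norm2 d) ^ 2 < 0 := by
  obtain ⟨l, hl, hle⟩ := exists_tendsto_norm1_slope_right x d
  have hpos : 0 < norm2 d ^ 2 := pow_pos (norm2_pos hd) 2
  refine ⟨fderiv ℝ f x d + μ * l, ?_, ?_, by nlinarith⟩
  · have hfd := (hf.hasFDerivAt.hasLineDerivAt d).tendsto_slope_zero_right
    refine (hfd.add (hl.const_mul μ)).congr fun t => ?_
    rw [hF, hF, smul_eq_mul]
    ring
  · have h0 := hmin 0
    rw [hφ, hφ, norm2_zero, map_zero, smul_zero, add_zero] at h0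
    have h1 : μ * l ≤ μ / h * norm1 (x + h • d) - μ / h * norm1 x :=
      (mul_le_mul_of_nonneg_left (hle h hh0) hμ.le).trans_eq (by ring)
    linarith
end

section
/- Let f : ℝⁿ → ℝ be differentiable at x, let μ > 0, δ ∈ (0, 1), h > 0, d ∈ ℝⁿ, and let F(x) = f(x) + μ‖x‖₁. Set Δ = ∇f(x)ᵀd + μ(‖x + h·d‖₁ − ‖x‖₁)/h and suppose Δ < 0. Then there exists ᾱ ∈ (0, h] such that F(x + α·d) ≤ F(x) + δ·α·Δ for every α ∈ (0, ᾱ]. -/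
theorem norm1_add_smul_sub_le {n : ℕ} (x d : Fin n → ℝ) {h α : ℝ} (hα : 0 ≤ α) (hh : 0 < h)
    (hαh : α ≤ h) :
    norm1 (x + α • d) - norm1 x ≤ α * ((norm1 (x + h • d) - norm1 x) / h) := by
  have ht0 : 0 ≤ α / h := by positivity
  have ht1 : 0 ≤ 1 - α / h := sub_nonneg.2 ((div_le_one hh).2 hαh)
  have key : norm1 (x + α • d) ≤ (1 - α / h) * norm1 x + α / h * norm1 (x + h • d) := by
    simp only [norm1, Finset.mul_sum, ← Finset.sum_add_distrib]
    refine Finset.sum_le_sum fun i _ => ?_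
    have e : (x + α • d) i = (1 - α / h) * x i + α / h * (x + h • d) i := by
      simp only [Pi.add_apply, Pi.smul_apply, smul_eq_mul]
      field_simp
      ring
    rw [e]
    refine (abs_add_le _ _).trans_eq ?_
    rw [abs_mul, abs_mul, abs_of_nonneg ht0, abs_of_nonneg ht1]
  calc norm1 (x + α • d) - norm1 x
      ≤ (1 - α / h) * norm1 x + α / h * norm1 (x + h • d) - norm1 x := by gcongr
    _ = α * ((norm1 (x + h • d) - norm1 x) / h) := by ring

/-- The increment of `f` along `d` is eventually below any line of slope exceeding the
directional derivative. -/
theorem DifferentiableAt.eventually_sub_lt_mul {E : Type*} [NormedAddCommGroup E]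
    [NormedSpace ℝ E] {f : E → ℝ} {x : E} (hf : DifferentiableAt ℝ f x) (d : E) {c : ℝ}
    (hc : fderiv ℝ f x d < c) :
    ∀ᶠ α in nhdsWithin (0 : ℝ) (Set.Ioi 0), f (x + α • d) - f x < α * c := by
  have hlim := (hf.hasFDerivAt.hasLineDerivAt d).tendsto_slope_zero_right
  filter_upwards [hlim.eventually_lt_const hc, self_mem_nhdsWithin] with α h1 h2
  rwa [smul_eq_mul, inv_mul_lt_iff₀ h2] at h1

/-- Let `f : ℝⁿ → ℝ` be differentiable at `x`, `μ > 0`, `δ ∈ (0,1)`, `h > 0`,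
`d ∈ ℝⁿ`, and `F(x) = f(x) + μ‖x‖₁`. Set `Δ = ∇f(x)ᵀd + μ(‖x + h·d‖₁ − ‖x‖₁)/h` and
suppose `Δ < 0`. Then there exists `ᾱ ∈ (0, h]` such that
`F(x + α·d) ≤ F(x) + δ·α·Δ` for every `α ∈ (0, ᾱ]`. -/
theorem line_search_well_defined {n : ℕ} (f : (Fin n → ℝ) → ℝ) (x : Fin n → ℝ)
    (hf : DifferentiableAt ℝ f x) (μ δ h : ℝ)
    (hμ : 0 < μ) (hδ0 : 0 < δ) (hδ1 : δ < 1) (hh : 0 < h) (d : Fin n → ℝ)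
    (F : (Fin n → ℝ) → ℝ) (hF : ∀ y, F y = f y + μ * norm1 y)
    (Δ : ℝ) (hΔ : Δ = fderiv ℝ f x d + μ * (norm1 (x + h • d) - norm1 x) / h)
    (hΔneg : Δ < 0) :
    ∃ αbar : ℝ, αbar ∈ Set.Ioc (0 : ℝ) h ∧
      ∀ α ∈ Set.Ioc (0 : ℝ) αbar, F (x + α • d) ≤ F x + δ * α * Δ := by
  have hc : fderiv ℝ f x d < fderiv ℝ f x d - (1 - δ) * Δ := by nlinarith
  obtain ⟨u, hu, hsub⟩ := mem_nhdsGT_iff_exists_Ioc_subset.1 (hf.eventually_sub_lt_mul d hc)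
  refine ⟨min u h, ⟨lt_min hu hh, min_le_right _ _⟩, fun α hα => ?_⟩
  have hfα : f (x + α • d) - f x < α * (fderiv ℝ f x d - (1 - δ) * Δ) :=
    hsub ⟨hα.1, hα.2.trans (min_le_left _ _)⟩
  have hnorm := mul_le_mul_of_nonneg_left
    (norm1_add_smul_sub_le x d hα.1.le hh (hα.2.trans (min_le_right _ _))) hμ.le
  have hαΔ : α * Δ =
      α * fderiv ℝ f x d + μ * (α * ((norm1 (x + h • d) - norm1 x) / h)) := by
    rw [hΔ]; ring
  rw [hF, hF]
  linarith
end
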